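/- Let β be a Pisot or Salem number with β > √φ, where φ = (1+√5)/2 is the golden ratio (so β > 1.272019649…). Then the real numbers 1, Σ_{n≥1} t(n)/β^n, Σ_{n≥1} t(n^2)/β^n, …, Σ_{n≥1} t(n^k)/β^n, … are linearly independent over the field ℚ(β); that is, for every integer k ≥ 0 and every a₀, a₁, …, a_k ∈ ℚ(β), if a₀ + Σ_{r=1}^{k} a_r · (Σ_{n≥1} t(n^r)/β^n) = 0 then a₀ = a₁ = ⋯ = a_k = 0. -/

import Mathlib

/-- The Thue–Morse indicator: `thueMorse n = 1` if the number of ones in the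
binary expansion of `n` is odd, and `0` if it is even. -/
def thueMorse (n : ℕ) : ℕ := (Nat.digits 2 n).sum % 2

/-- A real number `β` is a Pisot or Salem number if `β > 1`, `β` is an algebraic
integer, and every Galois conjugate of `β` other than `β` itself has absolute
value at most `1`. -/
def IsPisotOrSalem (β : ℝ) : Prop :=
  1 < β ∧ IsIntegral ℤ β ∧
    ∀ z : ℂ, Polynomial.aeval z (minpoly ℚ β) = 0 → z ≠ (β : ℂ) → ‖z‖ ≤ 1

open Polynomial

/-- A Liouville-type bound: an integer polynomial bounded by `B` on the closed unit disc cannot take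
a very small nonzero value at a Pisot or Salem number. -/
lemma IsPisotOrSalem.exists_one_le_abs_aeval_mul_pow {β : ℝ} (hβ : IsPisotOrSalem β) :
    ∃ d : ℕ, ∀ (Q : ℤ[X]) (B : ℝ), 1 ≤ B → (∀ z : ℂ, ‖z‖ ≤ 1 → ‖aeval z Q‖ ≤ B) →
      aeval β Q ≠ 0 → 1 ≤ |aeval β Q| * B ^ d := by
  obtain ⟨-, hint, hconj⟩ := hβ
  have hintQ : IsIntegral ℚ β := hint.tower_top
  let K := IntermediateField.adjoin ℚ ({β} : Set ℝ)
  have : FiniteDimensional ℚ K := IntermediateField.adjoin.finiteDimensional hintQ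
  let g : K := IntermediateField.AdjoinSimple.gen ℚ β
  have hgβ : algebraMap K ℝ g = β := IntermediateField.AdjoinSimple.algebraMap_gen ℚ β
  have hg : IsIntegral ℤ g := by
    rw [← isIntegral_algebraMap_iff (B := ℝ) (algebraMap K ℝ).injective, hgβ]
    exact hint
  let σ₀ : K →ₐ[ℚ] ℂ := (IsScalarTower.toAlgHom ℚ ℝ ℂ).comp (IsScalarTower.toAlgHom ℚ K ℝ)
  have hσ₀ : ∀ y : K, σ₀ y = ((algebraMap K ℝ y : ℝ) : ℂ) := fun y => rfl
  have hext : ∀ σ : K →ₐ[ℚ] ℂ, σ g = β → σ = σ₀ := by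
    intro σ hσ
    apply IntermediateField.algHom_ext_of_eq_adjoin ℚ (S := K) (s := {β}) rfl
    intro x hx
    rw [Set.mem_singleton_iff] at hx
    subst hx
    exact hσ.trans ((congrArg Complex.ofReal hgβ).symm.trans (hσ₀ g).symm)
  classical
  refine ⟨(Finset.univ.erase σ₀).card, fun Q B hB hQ hne => ?_⟩
  let x : K := aeval g Q
  have hxβ : algebraMap K ℝ x = aeval β Q := by
    rw [← hgβ, aeval_algebraMap_apply]
  have hx0 : x ≠ 0 := by
    intro h
    rw [← hxβ, h, map_zero] at hne
    exact hne rfl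
  have hxint : IsIntegral ℤ x := by
    exact IsIntegral.of_mem_of_fg _ hg.fg_adjoin_singleton _ (aeval_mem_adjoin_singleton ℤ g)
  have hnorm : 1 ≤ ‖algebraMap ℚ ℂ (Algebra.norm ℚ x)‖ := by
    obtain ⟨z, hz⟩ := IsIntegrallyClosed.isIntegral_iff.mp (Algebra.isIntegral_norm ℚ hxint)
    have hz0 : z ≠ 0 := by
      rintro rfl
      rw [map_zero] at hz
      exact hx0 (Algebra.norm_eq_zero_iff.mp hz.symm)
    rw [← hz]
    simp only [eq_intCast, map_intCast]
    rw [Complex.norm_intCast]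
    exact_mod_cast Int.one_le_abs hz0
  rw [Algebra.norm_eq_prod_embeddings ℚ ℂ x, norm_prod,
    ← Finset.mul_prod_erase _ _ (Finset.mem_univ σ₀), hσ₀, hxβ, Complex.norm_real,
    Real.norm_eq_abs] at hnorm
  refine hnorm.trans (mul_le_mul_of_nonneg_left ?_ (abs_nonneg _))
  rw [← Finset.prod_const]
  refine Finset.prod_le_prod (fun _ _ => norm_nonneg _) fun σ hσ => ?_
  have hσx : σ x = aeval (σ g) Q := by
    have := Polynomial.map_aeval_eq_aeval_map (φ := RingHom.id ℤ) (ψ := (σ : K →+* ℂ))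
      (RingHom.ext_int _ _) Q g
    simpa using this
  rw [hσx]
  refine hQ _ (hconj _ ?_ fun h => Finset.ne_of_mem_erase hσ (hext σ h))
  have : minpoly ℚ β = minpoly ℚ g := by
    rw [← hgβ, minpoly.algebraMap_eq (algebraMap K ℝ).injective]
  rw [this, aeval_algHom_apply, minpoly.aeval, map_zero]

lemma exists_intPolynomial_of_mem_adjoin {β : ℝ} (hβ : IsIntegral ℤ β) (k : ℕ) (a : ℕ → ℝ)
    (ha : ∀ i ≤ k, a i ∈ IntermediateField.adjoin ℚ ({β} : Set ℝ)) :
    ∃ (D : ℤ) (P : ℕ → ℤ[X]), D ≠ 0 ∧ ∀ i ≤ k, aeval β (P i) = D * a i := by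
  have h1 : ∀ i, ∃ (D : ℤ) (p : ℤ[X]), D ≠ 0 ∧ (i ≤ k → aeval β p = D * a i) := by
    intro i
    by_cases hi : i ≤ k
    · have hmem := ha i hi
      rw [← IntermediateField.mem_toSubalgebra,
        IntermediateField.adjoin_simple_toSubalgebra_of_isAlgebraic
          (hβ.tower_top (A := ℚ)).isAlgebraic,
        Algebra.adjoin_singleton_eq_range_aeval] at hmem
      obtain ⟨p, hp⟩ := hmem
      obtain ⟨b, hbmem, hb⟩ := IsLocalization.integerNormalization_spec (nonZeroDivisors ℤ) p
      refine ⟨b, IsLocalization.integerNormalization (nonZeroDivisors ℤ) p,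
        nonZeroDivisors.ne_zero hbmem, fun _ => ?_⟩
      have := congrArg (aeval β) hb
      rw [aeval_map_algebraMap] at this
      rw [this, ← hp]
      simp [Algebra.smul_def]
    · exact ⟨1, 0, one_ne_zero, fun h => absurd h hi⟩
  choose D p hD hp using h1
  refine ⟨∏ i ∈ Finset.range (k + 1), D i,
    fun i => C (∏ j ∈ (Finset.range (k + 1)).erase i, D j) * p i,
    Finset.prod_ne_zero_iff.mpr fun i _ => hD i, fun i hi => ?_⟩
  rw [← Finset.prod_erase_mul _ _ (Finset.mem_range.mpr (Nat.lt_succ_of_le hi)), map_mul,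
    hp i hi, aeval_C]
  simp [mul_assoc]

lemma hasSum_one_div_pow_succ {β : ℝ} (hβ : 1 < β) :
    HasSum (fun n : ℕ => 1 / β ^ (n + 1)) (1 / (β - 1)) := by
  have h := (hasSum_geometric_of_lt_one (r := β⁻¹) (by positivity)
    (inv_lt_one_of_one_lt₀ hβ)).mul_left β⁻¹
  have hβ0 : β ≠ 0 := by positivity
  have hβ1 : β - 1 ≠ 0 := by linarith
  have e : β⁻¹ * (1 - β⁻¹)⁻¹ = 1 / (β - 1) := by
    rw [show 1 - β⁻¹ = (β - 1) / β by field_simp]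
    field_simp
  rw [e] at h
  refine h.congr_fun ?_
  intro n
  rw [inv_pow, ← mul_inv, one_div, pow_succ']

lemma summable_div_pow_succ {β C : ℝ} (hβ : 1 < β) {u : ℕ → ℝ} (hu : ∀ n, |u n| ≤ C) :
    Summable fun n : ℕ => u n / β ^ (n + 1) := by
  refine Summable.of_norm_bounded ((hasSum_one_div_pow_succ hβ).summable.mul_left C) fun n => ?_
  rw [Real.norm_eq_abs, abs_div, abs_of_pos (by positivity : 0 < β ^ (n + 1)), mul_one_div]
  gcongr
  exact hu n

lemma abs_tsum_div_pow_succ_le {β C : ℝ} (hβ : 1 < β) {u : ℕ → ℝ} (hu : ∀ n, |u n| ≤ C) :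
    |∑' n : ℕ, u n / β ^ (n + 1)| ≤ C / (β - 1) := by
  rw [← Real.norm_eq_abs, ← mul_one_div]
  refine tsum_of_norm_bounded ((hasSum_one_div_pow_succ hβ).mul_left C) fun n => ?_
  rw [Real.norm_eq_abs, abs_div, abs_of_pos (by positivity : 0 < β ^ (n + 1)), mul_one_div]
  gcongr
  exact hu n

lemma tsum_div_pow_succ_split {β C : ℝ} (hβ : 1 < β) {u : ℕ → ℝ} (hu : ∀ n, |u n| ≤ C) (L : ℕ) :
    ∑' n : ℕ, u n / β ^ (n + 1) = ∑ n ∈ Finset.range L, u n / β ^ (n + 1)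
      + (∑' n : ℕ, u (L + n) / β ^ (n + 1)) / β ^ L := by
  rw [← (summable_div_pow_succ hβ hu).sum_add_tsum_nat_add L, ← tsum_div_const]
  congr 1
  refine tsum_congr fun n => ?_
  rw [div_div, ← pow_add, add_comm n L]
  congr 2
  ring

/-- If `δ` vanishes before `L`, the next `A` terms are controlled by the tail of the series. -/
lemma abs_sum_range_le_of_tsum_eq_zero {β C : ℝ} (hβ : 1 < β) {δ : ℕ → ℝ} (hδ : ∀ n, |δ n| ≤ C)
    {L : ℕ} (hL : ∀ n < L, δ n = 0) (h0 : ∑' n : ℕ, δ n / β ^ (n + 1) = 0) (A : ℕ) :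
    |∑ i ∈ Finset.range A, δ (L + i) / β ^ (i + 1)| ≤ C / (β - 1) / β ^ A := by
  have h1 := tsum_div_pow_succ_split hβ hδ L
  rw [h0, Finset.sum_eq_zero (fun n hn => by rw [hL n (Finset.mem_range.mp hn), zero_div]),
    zero_add, eq_comm, div_eq_zero_iff, or_iff_left (by positivity),
    tsum_div_pow_succ_split hβ (fun n => hδ (L + n)) A] at h1
  rw [eq_neg_of_add_eq_zero_left h1, abs_neg, abs_div, abs_of_pos (by positivity : 0 < β ^ A)]
  gcongr
  exact abs_tsum_div_pow_succ_le hβ fun n => hδ _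

lemma abs_tsum_div_pow_succ_le_of_eq_zero {β C : ℝ} (hβ : 1 < β) {δ : ℕ → ℝ} (hδ : ∀ n, |δ n| ≤ C)
    {L : ℕ} (hL : ∀ n < L, δ n = 0) :
    |∑' n : ℕ, δ n / β ^ (n + 1)| ≤ C / (β - 1) / β ^ L := by
  rw [tsum_div_pow_succ_split hβ hδ L,
    Finset.sum_eq_zero (fun n hn => by rw [hL n (Finset.mem_range.mp hn), zero_div]),
    zero_add, abs_div, abs_of_pos (by positivity : 0 < β ^ L)]
  gcongr
  exact abs_tsum_div_pow_succ_le hβ fun n => hδ _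

/-- The integer polynomial whose value at `β` is minus the tail, from index `N` on and rescaled by
`β ^ N`, of a series `∑ W n / β ^ (n + 1)` with sum `-P`. -/
noncomputable def tailPolynomial (P : ℤ[X]) (W : ℕ → ℤ[X]) : ℕ → ℤ[X]
  | 0 => P
  | N + 1 => X * tailPolynomial P W N + W N

lemma norm_aeval_tailPolynomial_le {P : ℤ[X]} {W : ℕ → ℤ[X]} {C : ℝ}
    {z : ℂ} (hz : ‖z‖ ≤ 1) (hP : ‖aeval z P‖ ≤ C) (hW : ∀ n, ‖aeval z (W n)‖ ≤ C) (N : ℕ) :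
    ‖aeval z (tailPolynomial P W N)‖ ≤ C * (N + 1) := by
  induction N with
  | zero => simpa [tailPolynomial] using hP
  | succ N ih =>
    rw [tailPolynomial, map_add, map_mul, aeval_X]
    calc ‖z * aeval z (tailPolynomial P W N) + aeval z (W N)‖
        ≤ ‖z‖ * ‖aeval z (tailPolynomial P W N)‖ + ‖aeval z (W N)‖ := by
          rw [← norm_mul]; exact norm_add_le _ _
      _ ≤ 1 * (C * (N + 1)) + C := by gcongr; exact hW N
      _ = C * ((N + 1 : ℕ) + 1) := by push_cast; ring

lemma aeval_tailPolynomial {β C : ℝ} (hβ : 1 < β) {P : ℤ[X]} {W : ℕ → ℤ[X]}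
    (hW : ∀ n, |aeval β (W n)| ≤ C)
    (h0 : aeval β P + ∑' n : ℕ, aeval β (W n) / β ^ (n + 1) = 0) (N : ℕ) :
    aeval β (tailPolynomial P W N) = -∑' n : ℕ, aeval β (W (N + n)) / β ^ (n + 1) := by
  induction N with
  | zero => simpa [tailPolynomial] using eq_neg_of_add_eq_zero_left h0
  | succ N ih =>
    have h := tsum_div_pow_succ_split hβ (u := fun n => aeval β (W (N + n))) (fun n => hW _) 1
    rw [tailPolynomial, map_add, map_mul, aeval_X, ih, h]
    have hβ0 : β ≠ 0 := by positivity
    simp only [Finset.range_one, Finset.sum_singleton, add_zero, zero_add, pow_one, add_assoc]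
    field_simp
    ring

/-- Tails that agree on a window which is long compared to the logarithm of the starting points
have the same sum. -/
lemma IsPisotOrSalem.exists_tsum_eq_tsum {β : ℝ} (hβ : IsPisotOrSalem β)
    {P : ℤ[X]} {W : ℕ → ℤ[X]} {C : ℝ} (hC : 1 ≤ C)
    (hP : ∀ z : ℂ, ‖z‖ ≤ 1 → ‖aeval z P‖ ≤ C)
    (hW : ∀ n, ∀ z : ℂ, ‖z‖ ≤ 1 → ‖aeval z (W n)‖ ≤ C) (hWβ : ∀ n, |aeval β (W n)| ≤ C)
    (h0 : aeval β P + ∑' n : ℕ, aeval β (W n) / β ^ (n + 1) = 0) :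
    ∃ (d : ℕ) (K : ℝ), ∀ N M L : ℕ,
      (∀ n < L, aeval β (W (N + n)) = aeval β (W (M + n))) →
      K * ((N : ℝ) + M + 2) ^ d < β ^ L →
      ∑' n : ℕ, (aeval β (W (N + n)) - aeval β (W (M + n))) / β ^ (n + 1) = 0 := by
  obtain ⟨d, hd⟩ := hβ.exists_one_le_abs_aeval_mul_pow
  have h1 := hβ.1
  refine ⟨d, (C + C) / (β - 1) * C ^ d, fun N M L hNM hL => ?_⟩
  have hδ : ∀ n, |aeval β (W (N + n)) - aeval β (W (M + n))| ≤ C + C := fun n =>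
    (abs_sub _ _).trans (add_le_add (hWβ _) (hWβ _))
  have hdiff : aeval β (tailPolynomial P W M - tailPolynomial P W N)
      = ∑' n : ℕ, (aeval β (W (N + n)) - aeval β (W (M + n))) / β ^ (n + 1) := by
    simp_rw [sub_div]
    rw [(summable_div_pow_succ h1 fun n => hWβ (N + n)).tsum_sub
      (summable_div_pow_succ h1 fun n => hWβ (M + n)), map_sub, aeval_tailPolynomial h1 hWβ h0,
      aeval_tailPolynomial h1 hWβ h0]
    ring
  by_contra hne
  have hlow := hd (tailPolynomial P W M - tailPolynomial P W N) (C * ((N : ℝ) + M + 2))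
    (by nlinarith [Nat.cast_nonneg (α := ℝ) N, Nat.cast_nonneg (α := ℝ) M])
    (fun z hz => by
      rw [map_sub]
      refine (norm_sub_le _ _).trans ((add_le_add
        (norm_aeval_tailPolynomial_le hz (hP z hz) (fun n => hW n z hz) M)
        (norm_aeval_tailPolynomial_le hz (hP z hz) (fun n => hW n z hz) N)).trans_eq ?_)
      ring)
    (by rwa [hdiff])
  have hup := abs_tsum_div_pow_succ_le_of_eq_zero h1 hδ (L := L)
    fun n hn => sub_eq_zero.mpr (hNM n hn)
  rw [hdiff] at hlow
  have hβL : 0 < β ^ L := by positivity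
  have := hlow.trans (mul_le_mul_of_nonneg_right hup (by positivity))
  rw [div_mul_eq_mul_div, le_div_iff₀ hβL, one_mul, mul_pow, ← mul_assoc] at this
  exact absurd hL (not_lt.mpr this)

lemma exists_norm_aeval_le (Q : ℤ[X]) :
    ∃ C : ℝ, 0 ≤ C ∧ ∀ z : ℂ, ‖z‖ ≤ 1 → ‖aeval z Q‖ ≤ C := by
  refine ⟨Q.sum fun _ c => |(c : ℝ)|, Finset.sum_nonneg fun _ _ => abs_nonneg _, fun z hz => ?_⟩
  rw [aeval_eq_sum_range, Polynomial.sum_over_range _ (by simp)]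
  refine (norm_sum_le _ _).trans (Finset.sum_le_sum fun i _ => ?_)
  rw [zsmul_eq_mul, norm_mul, norm_pow, Complex.norm_intCast]
  exact mul_le_of_le_one_right (abs_nonneg _) (pow_le_one₀ (norm_nonneg _) hz)

lemma thueMorse_le_one (n : ℕ) : thueMorse n ≤ 1 := by
  unfold thueMorse; omega

lemma thueMorse_zero : thueMorse 0 = 0 := by simp [thueMorse]

lemma thueMorse_two_mul_add (n e : ℕ) (he : e < 2) :
    thueMorse (2 * n + e) = (thueMorse n + e) % 2 := by
  unfold thueMorse
  rcases Nat.eq_zero_or_pos (2 * n + e) with h | h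
  · obtain ⟨rfl, rfl⟩ : n = 0 ∧ e = 0 := by omega
    simp
  · rw [Nat.digits_def' (by norm_num) h, List.sum_cons, show (2 * n + e) / 2 = n by omega,
      show (2 * n + e) % 2 = e by omega]
    omega

lemma thueMorse_add_two_pow_mul {s a : ℕ} (b : ℕ) (ha : a < 2 ^ s) :
    thueMorse (a + 2 ^ s * b) = (thueMorse a + thueMorse b) % 2 := by
  induction s generalizing a with
  | zero =>
    obtain rfl : a = 0 := by simpa using ha
    have := thueMorse_le_one b
    simp only [thueMorse_zero, pow_zero, one_mul, zero_add]
    omega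
  | succ s ih =>
    have h1 : a / 2 < 2 ^ s := by rw [pow_succ] at ha; omega
    have h2 : a + 2 ^ (s + 1) * b = 2 * (a / 2 + 2 ^ s * b) + a % 2 := by
      rw [pow_succ]; have := Nat.div_add_mod a 2; linarith
    have h3 := thueMorse_two_mul_add (a / 2) (a % 2) (by omega)
    rw [Nat.div_add_mod] at h3
    rw [h2, thueMorse_two_mul_add _ _ (by omega), ih h1, h3]
    omega

lemma thueMorse_two_pow_sub_one (g : ℕ) : thueMorse (2 ^ g - 1) = g % 2 := by
  induction g with
  | zero => simp [thueMorse_zero]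
  | succ g ih =>
    have := Nat.one_le_two_pow (n := g)
    rw [show 2 ^ (g + 1) - 1 = 2 * (2 ^ g - 1) + 1 by rw [pow_succ]; omega,
      thueMorse_two_mul_add _ _ (by norm_num), ih]
    omega

/-- The hypothesis says that the binary expansion of `y` ends in exactly `g` ones. -/
lemma thueMorse_one_add {g y : ℕ} (hy : y + 1 ≡ 2 ^ g [MOD 2 ^ (g + 1)]) :
    thueMorse (1 + y) = (1 + thueMorse y + g) % 2 := by
  have hg := Nat.one_le_two_pow (n := g)
  have hy' := Nat.mod_add_div (y + 1) (2 ^ (g + 1))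
  rw [hy, Nat.mod_eq_of_lt (Nat.pow_lt_pow_right (by norm_num) (by omega)), pow_succ,
    mul_assoc] at hy'
  set z := (y + 1) / (2 ^ g * 2)
  have h1 : y = (2 ^ g - 1) + 2 ^ g * (2 * z + 0) := by rw [add_zero]; omega
  have h2 : 1 + y = 0 + 2 ^ g * (2 * z + 1) := by rw [mul_add]; omega
  rw [h2, thueMorse_add_two_pow_mul _ (by positivity), thueMorse_two_mul_add _ _ (by norm_num), h1,
    thueMorse_add_two_pow_mul _ (by omega), thueMorse_two_mul_add _ _ (by norm_num),
    thueMorse_two_pow_sub_one, thueMorse_zero]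
  omega

/-- Expansion in base `2 ^ s`: the digits `c j` do not interact. -/
lemma thueMorse_sum_two_pow {s : ℕ} (r : ℕ) (c : ℕ → ℕ) (hc : ∀ j < r, c j < 2 ^ s) :
    thueMorse (∑ j ∈ Finset.range r, c j * (2 ^ s) ^ j)
      = (∑ j ∈ Finset.range r, thueMorse (c j)) % 2 := by
  induction r generalizing c with
  | zero => simp [thueMorse_zero]
  | succ r ih =>
    have h := ih (fun j => c (j + 1)) fun j hj => hc _ (by omega)
    have h2 : ∑ j ∈ Finset.range r, c (j + 1) * (2 ^ s) ^ (j + 1)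
        = 2 ^ s * ∑ j ∈ Finset.range r, c (j + 1) * (2 ^ s) ^ j := by
      rw [Finset.mul_sum]
      exact Finset.sum_congr rfl fun j _ => by ring
    rw [Finset.sum_range_succ', Finset.sum_range_succ', h2, pow_zero, mul_one, add_comm,
      thueMorse_add_two_pow_mul _ (hc 0 (by omega)), h]
    omega

lemma two_pow_mul_add_pow (s q n r : ℕ) :
    (2 ^ s * q + n) ^ r
      = ∑ j ∈ Finset.range (r + 1), (r.choose j * q ^ j * n ^ (r - j)) * (2 ^ s) ^ j := by
  rw [add_pow]
  exact Finset.sum_congr rfl fun j _ => by rw [mul_pow]; push_cast; ring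

lemma thueMorse_two_pow_mul_add_pow {s q n r : ℕ}
    (h : ∀ j ≤ r, r.choose j * q ^ j * n ^ (r - j) < 2 ^ s) :
    thueMorse ((2 ^ s * q + n) ^ r)
      = (∑ j ∈ Finset.range (r + 1), thueMorse (r.choose j * q ^ j * n ^ (r - j))) % 2 := by
  rw [two_pow_mul_add_pow, thueMorse_sum_two_pow _ _ fun j hj => h j (by omega)]

/-- The two lowest digits may overlap, in which case they are kept together. -/
lemma thueMorse_two_pow_mul_add_pow_of_overlap {s q n r : ℕ}
    (h : ∀ j ≤ r, 2 ≤ j → r.choose j * q ^ j * n ^ (r - j) < 2 ^ s) (hr : 1 ≤ r)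
    (h0 : n ^ r + 2 ^ s * (r * q * n ^ (r - 1)) < 2 ^ (2 * s)) :
    thueMorse ((2 ^ s * q + n) ^ r)
      = (thueMorse (n ^ r + 2 ^ s * (r * q * n ^ (r - 1)))
        + ∑ j ∈ Finset.range (r - 1),
          thueMorse (r.choose (j + 2) * q ^ (j + 2) * n ^ (r - (j + 2)))) % 2 := by
  obtain ⟨r, rfl⟩ := Nat.exists_eq_add_of_le' hr
  have h2 : ∑ j ∈ Finset.range r,
      (r + 1).choose (j + 2) * q ^ (j + 2) * n ^ (r + 1 - (j + 2)) * (2 ^ s) ^ (j + 2)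
      = 2 ^ (2 * s) * ∑ j ∈ Finset.range r,
        (r + 1).choose (j + 2) * q ^ (j + 2) * n ^ (r + 1 - (j + 2)) * (2 ^ s) ^ j := by
    rw [Finset.mul_sum]
    exact Finset.sum_congr rfl fun j _ => by ring
  have h3 : (2 ^ s * q + n) ^ (r + 1) = n ^ (r + 1) + 2 ^ s * ((r + 1) * q * n ^ (r + 1 - 1))
      + 2 ^ (2 * s) * ∑ j ∈ Finset.range r,
        (r + 1).choose (j + 2) * q ^ (j + 2) * n ^ (r + 1 - (j + 2)) * (2 ^ s) ^ j := by
    rw [two_pow_mul_add_pow, Finset.sum_range_succ', Finset.sum_range_succ', ← h2]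
    simp
    ring
  rw [h3, thueMorse_add_two_pow_mul _ h0,
    thueMorse_sum_two_pow r
      (fun j => (r + 1).choose (j + 2) * q ^ (j + 2) * n ^ (r + 1 - (j + 2)))
      fun j hj => h (j + 2) (by omega) (by omega)]
  simp

/-- Some `y` ends in an odd number of binary ones while `y * 3 ^ (m - 1)` ends in an even number. -/
lemma exists_trailing_ones (m : ℕ) (hm : 2 ≤ m) :
    ∃ y g g' : ℕ, g % 2 = 1 ∧ g' % 2 = 0 ∧ y + 1 ≡ 2 ^ g [MOD 2 ^ (g + 1)] ∧
      y * 3 ^ (m - 1) + 1 ≡ 2 ^ g' [MOD 2 ^ (g' + 1)] := by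
  have hmod : ∀ {n g z : ℕ}, n = 2 ^ g * (2 * z + 1) → n ≡ 2 ^ g [MOD 2 ^ (g + 1)] := by
    intro n g z h
    rw [h, show 2 ^ g * (2 * z + 1) = 2 ^ g + 2 ^ (g + 1) * z by ring]
    simp [Nat.ModEq]
  rcases Nat.even_or_odd' (m - 1) with ⟨e, he | he⟩
  · have hc : (3 : ℕ) ^ (m - 1) = 9 ^ e := by rw [he, pow_mul]; norm_num
    have hc1 : 9 < 9 ^ e * 9 := by
      have : 1 < 9 ^ e := Nat.one_lt_pow (by omega) (by norm_num)
      omega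
    obtain ⟨f, u, ⟨u', rfl⟩, hfu⟩ := Nat.exists_eq_two_pow_mul_odd (n := 9 ^ e - 1) (by omega)
    obtain ⟨w, hw⟩ : ∃ w, 9 ^ e = 4 * w + 1 := by
      have : 9 ^ e % 4 = 1 := by rw [Nat.pow_mod]; norm_num
      exact ⟨9 ^ e / 4, by omega⟩
    have hf := Nat.one_le_two_pow (n := f)
    have hc' : 9 ^ e = 2 ^ f * (2 * u' + 1) + 1 := by omega
    rcases Nat.mod_two_eq_zero_or_one f with hpar | hpar
    · refine ⟨2 ^ (f + 1) - 1, f + 1, f, by omega, hpar, hmod (z := 0) (by rw [pow_succ]; omega),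
        hmod (z := 2 ^ (f + 1) * u' + 2 ^ f - u') ?_⟩
      have : u' ≤ 2 ^ (f + 1) * u' := Nat.le_mul_of_pos_left _ (by positivity)
      rw [hc, hc']
      zify [show 1 ≤ 2 ^ (f + 1) by rw [pow_succ]; omega,
        show u' ≤ 2 ^ (f + 1) * u' + 2 ^ f by omega]
      ring
    · refine ⟨2 ^ f * (2 * u' + 3) - 1, f, f + 1, hpar, by omega,
        hmod (z := u' + 1) ?_, hmod (z := w * (2 * u' + 3)) ?_⟩
      · have : 0 < 2 ^ f * (2 * u' + 3) := by positivity
        rw [Nat.sub_add_cancel this]; ring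
      · have h1 : 1 ≤ 2 ^ f * (2 * u' + 3) := Nat.succ_le_of_lt (by positivity)
        rw [hc]
        zify [h1] at hw hc' ⊢
        have h2 : (2 : ℤ) ^ f * (2 * u' + 1) = 4 * w := by linarith
        rw [hw]
        linear_combination h2
  · refine ⟨1, 1, 2, rfl, rfl, rfl, ?_⟩
    rw [he, pow_succ 3, pow_mul]
    have : (3 ^ 2) ^ e % 8 = 1 := by rw [Nat.pow_mod]; norm_num
    change _ % 8 = 4 % 8
    omega

lemma exists_multiplier_trailing_ones (m m' : ℕ) (hm : 2 ≤ m) (hm' : Odd m') :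
    ∃ q g g' : ℕ, 1 ≤ q ∧ g % 2 = 1 ∧ g' % 2 = 0 ∧ m' * q + 1 ≡ 2 ^ g [MOD 2 ^ (g + 1)] ∧
      m' * q * 3 ^ (m - 1) + 1 ≡ 2 ^ g' [MOD 2 ^ (g' + 1)] := by
  obtain ⟨y, g, g', hg, hg', h1, h2⟩ := exists_trailing_ones m hm
  obtain ⟨i, -, hi⟩ := Nat.exists_mul_mod_eq_one_of_coprime
    (Nat.Coprime.pow_right (g + g' + 1) hm'.coprime_two_right)
    (Nat.one_lt_two_pow (by omega))
  have hi' : m' * i ≡ 1 [MOD 2 ^ (g + g' + 1)] := by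
    rw [Nat.ModEq, hi, Nat.mod_eq_of_lt (Nat.one_lt_two_pow (by omega))]
  have hq : m' * (i * y + 2 ^ (g + g' + 1)) ≡ y [MOD 2 ^ (g + g' + 1)] := by
    rw [mul_add, ← mul_assoc]
    simpa [Nat.ModEq] using hi'.mul_right y
  refine ⟨i * y + 2 ^ (g + g' + 1), g, g', ?_, hg, hg', ?_, ?_⟩
  · have := Nat.one_le_two_pow (n := g + g' + 1); omega
  · exact ((hq.of_dvd (pow_dvd_pow 2 (by omega))).add_right 1).trans h1
  · exact (((hq.of_dvd (pow_dvd_pow 2 (by omega))).mul_right _).add_right 1).trans h2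

/-- The bounds under which, for `n < 2 ^ p + A` and `r ≤ m`, the base `2 ^ (m * p - v)` digits of
`(2 ^ (m * p - v) * q + n) ^ r` do not interact, except possibly for the lowest two when `r = m`. -/
def WindowBound (m q v A p : ℕ) : Prop :=
  v ≤ m * p ∧ ∀ n < 2 ^ p + A, n ^ m < 2 ^ (m * p + 1) ∧
    ∀ r ≤ m, ∀ j ≤ r, (r < m ∨ 1 ≤ j) →
      r.choose j * q ^ j * n ^ (r - j) + 2 ^ (v + 1) ≤ 2 ^ (m * p - v)

lemma eventually_windowBound {m q : ℕ} (hm : 1 ≤ m) (hq : 1 ≤ q) (v A : ℕ) :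
    ∀ᶠ p in Filter.atTop, WindowBound m q v A p := by
  have htop : Filter.Tendsto (fun p : ℕ => (2 : ℕ) ^ p) Filter.atTop Filter.atTop :=
    tendsto_pow_atTop_atTop_of_one_lt (by norm_num)
  have hpow : ∀ᶠ p : ℕ in Filter.atTop, (1 + (A : ℝ) / 2 ^ p) ^ m < 2 := by
    have h1 : Filter.Tendsto (fun p : ℕ => (1 + (A : ℝ) / 2 ^ p) ^ m) Filter.atTop
        (nhds ((1 + 0) ^ m)) :=
      ((tendsto_pow_atTop_atTop_of_one_lt (by norm_num : (1 : ℝ) < 2)).const_div_atTop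
        (A : ℝ) |>.const_add 1).pow m
    exact h1.eventually_lt_const (by norm_num)
  filter_upwards [hpow, htop.eventually_ge_atTop A, Filter.eventually_ge_atTop v,
    htop.eventually_ge_atTop ((2 ^ m * q ^ m * 2 ^ m + 2 ^ (v + 1)) * 2 ^ v)] with p h1 h2 h3 h4
  have hvp : v ≤ m * p := h3.trans (Nat.le_mul_of_pos_left p hm)
  refine ⟨hvp, fun n hn => ⟨?_, fun r hr j hj hrj => ?_⟩⟩
  · have h5 : (n : ℝ) ≤ 2 ^ p * (1 + (A : ℝ) / 2 ^ p) := by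
      rw [mul_add, mul_one, mul_div_cancel₀ _ (by positivity)]
      exact_mod_cast hn.le
    have h6 : (n : ℝ) ^ m < 2 ^ (m * p + 1) := by
      calc (n : ℝ) ^ m ≤ (2 ^ p * (1 + (A : ℝ) / 2 ^ p)) ^ m := by gcongr
        _ = 2 ^ (m * p) * (1 + (A : ℝ) / 2 ^ p) ^ m := by rw [mul_pow, ← pow_mul, mul_comm p m]
        _ < 2 ^ (m * p) * 2 := by gcongr
        _ = 2 ^ (m * p + 1) := by rw [pow_succ]
    exact_mod_cast h6
  · have hn' : n ≤ 2 ^ (p + 1) := by rw [pow_succ]; omega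
    have hpv : 2 ^ (m * p - v) * 2 ^ v = 2 ^ p * 2 ^ (p * (m - 1)) := by
      rw [← pow_add, ← pow_add, Nat.sub_add_cancel hvp]
      congr 1
      obtain ⟨m, rfl⟩ := Nat.exists_eq_add_of_le' hm
      simp; ring
    have hc : r.choose j ≤ 2 ^ m :=
      (Nat.choose_le_two_pow r j).trans (Nat.pow_le_pow_right (by norm_num) hr)
    have hqj : q ^ j ≤ q ^ m := Nat.pow_le_pow_right hq (hj.trans hr)
    have hnr : n ^ (r - j) ≤ 2 ^ m * 2 ^ (p * (m - 1)) := by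
      calc n ^ (r - j) ≤ (2 ^ (p + 1)) ^ (r - j) := Nat.pow_le_pow_left hn' _
        _ ≤ (2 ^ (p + 1)) ^ (m - 1) := Nat.pow_le_pow_right (by positivity) (by omega)
        _ = 2 ^ (m - 1) * 2 ^ (p * (m - 1)) := by
          rw [← pow_mul, ← pow_add]; congr 1; ring
        _ ≤ 2 ^ m * 2 ^ (p * (m - 1)) := by gcongr <;> omega
    have hone := Nat.one_le_two_pow (n := p * (m - 1))
    refine Nat.le_of_mul_le_mul_right ?_ (Nat.two_pow_pos v)
    rw [hpv]
    calc (r.choose j * q ^ j * n ^ (r - j) + 2 ^ (v + 1)) * 2 ^ v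
        ≤ (2 ^ m * q ^ m * (2 ^ m * 2 ^ (p * (m - 1))) + 2 ^ (v + 1) * 2 ^ (p * (m - 1)))
          * 2 ^ v := by
          gcongr
          exact Nat.le_mul_of_pos_right _ hone
      _ = (2 ^ m * q ^ m * 2 ^ m + 2 ^ (v + 1)) * 2 ^ v * 2 ^ (p * (m - 1)) := by ring
      _ ≤ 2 ^ p * 2 ^ (p * (m - 1)) := by gcongr

lemma WindowBound.thueMorse_eq_of_lt {m q v A p r n : ℕ} (h : WindowBound m q v A p)
    (hr : r < m) (hn : n < 2 ^ p + A) :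
    thueMorse ((2 ^ (m * p - v) * q + n) ^ r)
      = thueMorse ((2 ^ (m * p - v + 1) * q + n) ^ r) := by
  have hlt : ∀ j ≤ r, r.choose j * q ^ j * n ^ (r - j) < 2 ^ (m * p - v) := fun j hj =>
    (Nat.lt_add_of_pos_right (Nat.two_pow_pos (v + 1))).trans_le
      ((h.2 n hn).2 r hr.le j hj (Or.inl hr))
  rw [thueMorse_two_pow_mul_add_pow hlt, thueMorse_two_pow_mul_add_pow fun j hj =>
    (hlt j hj).trans (Nat.pow_lt_pow_right (by norm_num) (by omega))]

lemma WindowBound.thueMorse_add_thueMorse {m m' q v A p n l h : ℕ} (hm : 1 ≤ m)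
    (hm' : m = 2 ^ v * m') (hw : WindowBound m q v A p) (hn : n < 2 ^ p + A)
    (hl : l < 2 ^ (m * p)) (hlh : n ^ m = l + 2 ^ (m * p) * h) :
    (thueMorse ((2 ^ (m * p - v) * q + n) ^ m) + thueMorse ((2 ^ (m * p - v + 1) * q + n) ^ m)) % 2
      = (thueMorse (h + m' * q * n ^ (m - 1)) + thueMorse h
        + thueMorse (m' * q * n ^ (m - 1))) % 2 := by
  obtain ⟨hvp, hw⟩ := hw
  obtain ⟨hnm, hb⟩ := hw n hn
  set s := m * p - v with hs
  have hsv : m * p = s + v := by omega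
  have hv := Nat.two_pow_pos (v + 1)
  have hlt : ∀ j ≤ m, 2 ≤ j → m.choose j * q ^ j * n ^ (m - j) < 2 ^ s := fun j hj h2 => by
    have := hb m le_rfl j hj (Or.inr (by omega)); omega
  have hlt' : ∀ j ≤ m, 2 ≤ j → m.choose j * q ^ j * n ^ (m - j) < 2 ^ (s + 1) := fun j hj h2 =>
    (hlt j hj h2).trans (Nat.pow_lt_pow_right (by norm_num) (by omega))
  have h1 := hb m le_rfl 1 hm (Or.inr le_rfl)
  rw [Nat.choose_one_right, pow_one] at h1
  have hlow : n ^ m + 2 ^ s * (m * q * n ^ (m - 1)) < 2 ^ (2 * s) := by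
    calc n ^ m + 2 ^ s * (m * q * n ^ (m - 1))
        < 2 ^ (m * p + 1) + 2 ^ s * (m * q * n ^ (m - 1)) := by omega
      _ = 2 ^ s * (m * q * n ^ (m - 1) + 2 ^ (v + 1)) := by rw [hsv]; ring
      _ ≤ 2 ^ s * 2 ^ s := by gcongr
      _ = 2 ^ (2 * s) := by ring
  have hlow' : n ^ m + 2 ^ (s + 1) * (m * q * n ^ (m - 1)) < 2 ^ (2 * (s + 1)) := by
    calc n ^ m + 2 ^ (s + 1) * (m * q * n ^ (m - 1))
        ≤ 4 * (n ^ m + 2 ^ s * (m * q * n ^ (m - 1))) := by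
          rw [pow_succ, mul_comm (2 ^ s) 2, mul_assoc]; omega
      _ < 4 * 2 ^ (2 * s) := by gcongr
      _ = 2 ^ (2 * (s + 1)) := by ring
  have hmq : m * q * n ^ (m - 1) = 2 ^ v * (m' * q * n ^ (m - 1)) := by
    rw [← mul_assoc, ← mul_assoc, ← hm']
  have e1 : n ^ m + 2 ^ s * (m * q * n ^ (m - 1))
      = l + 2 ^ (m * p) * (h + m' * q * n ^ (m - 1)) := by
    rw [hlh, hsv, pow_add, hmq]
    ring
  have e2 : n ^ m + 2 ^ (s + 1) * (m * q * n ^ (m - 1))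
      = n ^ m + 2 ^ (m * p + 1) * (m' * q * n ^ (m - 1)) := by
    rw [hsv, hmq]
    ring
  rw [thueMorse_two_pow_mul_add_pow_of_overlap hlt hm hlow,
    thueMorse_two_pow_mul_add_pow_of_overlap hlt' hm hlow', e1, e2,
    thueMorse_add_two_pow_mul _ hl, thueMorse_add_two_pow_mul _ hnm, hlh,
    thueMorse_add_two_pow_mul _ hl]
  omega

lemma WindowBound.thueMorse_eq_of_lt_two_pow {m m' q v A p n : ℕ} (hm : 1 ≤ m)
    (hm' : m = 2 ^ v * m') (hw : WindowBound m q v A p) (hn : n < 2 ^ p) :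
    thueMorse ((2 ^ (m * p - v) * q + n) ^ m)
      = thueMorse ((2 ^ (m * p - v + 1) * q + n) ^ m) := by
  have hl : n ^ m < 2 ^ (m * p) := by
    rw [mul_comm, pow_mul]; exact Nat.pow_lt_pow_left hn (by omega)
  have := hw.thueMorse_add_thueMorse hm hm' (n := n) (by omega) hl (h := 0) (by ring)
  rw [zero_add, thueMorse_zero] at this
  have h1 := thueMorse_le_one ((2 ^ (m * p - v) * q + n) ^ m)
  have h2 := thueMorse_le_one ((2 ^ (m * p - v + 1) * q + n) ^ m)
  omega

/-- Past `2 ^ p` the two values differ exactly when the number `g` of trailing ones of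
`m' * q * n ^ (m - 1)` is odd. -/
lemma WindowBound.thueMorse_add_thueMorse_of_trailing_ones {m m' q v A p i g : ℕ} (hm : 1 ≤ m)
    (hm' : m = 2 ^ v * m') (hw : WindowBound m q v A p) (hi : i < A)
    (hg : m' * q * (2 ^ p + i) ^ (m - 1) + 1 ≡ 2 ^ g [MOD 2 ^ (g + 1)]) :
    (thueMorse ((2 ^ (m * p - v) * q + (2 ^ p + i)) ^ m)
      + thueMorse ((2 ^ (m * p - v + 1) * q + (2 ^ p + i)) ^ m)) % 2 = g % 2 := by
  have hn : 2 ^ p + i < 2 ^ p + A := by omega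
  have hle : 2 ^ (m * p) ≤ (2 ^ p + i) ^ m := by
    rw [mul_comm, pow_mul]; exact Nat.pow_le_pow_left (by omega) _
  have hlt := (hw.2 _ hn).1
  rw [pow_succ] at hlt
  rw [hw.thueMorse_add_thueMorse hm hm' hn (l := (2 ^ p + i) ^ m - 2 ^ (m * p)) (h := 1)
    (by omega) (by omega), thueMorse_one_add hg, show thueMorse 1 = 1 by simp [thueMorse]]
  omega

/-- The partial products of `∏ (1 - x ^ 2 ^ j)` stay away from zero. -/
lemma exists_le_prod_one_sub_pow_two_pow {x : ℝ} (hx0 : 0 ≤ x) (hx1 : x < 1) :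
    ∃ c : ℝ, 0 < c ∧ ∀ J : ℕ, c ≤ ∏ j ∈ Finset.range J, (1 - x ^ 2 ^ j) := by
  obtain ⟨K, hK⟩ := exists_nat_ge (1 / (1 - x))
  have hx1' : 0 < 1 - x := by linarith
  rw [div_le_iff₀ hx1'] at hK
  have hprod : ∀ J : ℕ, 0 ≤ ∏ j ∈ Finset.range J, (1 - x ^ 2 ^ j) := fun J =>
    Finset.prod_nonneg fun j _ => sub_nonneg.mpr (pow_le_one₀ hx0 hx1.le)
  refine ⟨(1 - x) ^ K, by positivity, fun J => ?_⟩
  have key : (1 - x) ^ K ≤ (∏ j ∈ Finset.range J, (1 - x ^ 2 ^ j)) * (1 - x ^ 2 ^ J) ^ K := by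
    induction J with
    | zero => simp
    | succ J ih =>
      refine ih.trans ?_
      have hle : x ^ 2 ^ J ≤ x := pow_le_of_le_one hx0 hx1.le (by positivity)
      have hsq : x ^ 2 ^ (J + 1) = (x ^ 2 ^ J) ^ 2 := by rw [pow_succ, pow_mul]
      rw [Finset.prod_range_succ, mul_assoc, hsq]
      have hy0 : 0 ≤ x ^ 2 ^ J := by positivity
      generalize x ^ 2 ^ J = y at *
      refine mul_le_mul_of_nonneg_left ?_ (hprod J)
      have hy1 : 0 ≤ 1 - y := by linarith
      have hbern : 1 + (K : ℝ) * y ≤ (1 + y) ^ K := one_add_mul_le_pow (by linarith) K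
      have hone : 1 ≤ (1 - y) * (1 + y) ^ K := by
        refine le_trans ?_ (mul_le_mul_of_nonneg_left hbern hy1)
        nlinarith [mul_nonneg hy0 (sub_nonneg.mpr hK),
          mul_nonneg (mul_nonneg hy0 (sub_nonneg.mpr hle)) (Nat.cast_nonneg (α := ℝ) K)]
      calc (1 - y) ^ K = 1 * (1 - y) ^ K := (one_mul _).symm
        _ ≤ (1 - y) * (1 + y) ^ K * (1 - y) ^ K := by gcongr
        _ = (1 - y) * (1 - y ^ 2) ^ K := by
          rw [mul_assoc, ← mul_pow]; congr 2; ring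
  exact key.trans (mul_le_of_le_one_right (hprod J) (pow_le_one₀
    (sub_nonneg.mpr (pow_le_one₀ hx0 hx1.le)) (by linarith [pow_nonneg hx0 (2 ^ J)])))

lemma sum_range_two_pow_thueMorse (x : ℝ) (J : ℕ) :
    ∑ i ∈ Finset.range (2 ^ J), (1 - 2 * (thueMorse i : ℝ)) * x ^ i
      = ∏ j ∈ Finset.range J, (1 - x ^ 2 ^ j) := by
  induction J with
  | zero => simp [thueMorse_zero]
  | succ J ih =>
    have h : ∀ i ∈ Finset.range (2 ^ J), (1 - 2 * (thueMorse (2 ^ J + i) : ℝ)) * x ^ (2 ^ J + i)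
        = -x ^ 2 ^ J * ((1 - 2 * (thueMorse i : ℝ)) * x ^ i) := by
      intro i hi
      have h1 := thueMorse_add_two_pow_mul 1 (Finset.mem_range.mp hi)
      rw [mul_one, add_comm i, show thueMorse 1 = 1 by simp [thueMorse]] at h1
      rw [h1]
      have := thueMorse_le_one i
      interval_cases thueMorse i <;> norm_num <;> ring
    rw [Finset.prod_range_succ, ← ih, pow_succ, mul_two, Finset.sum_range_add,
      Finset.sum_congr rfl h, ← Finset.mul_sum]
    ring

/-- A sparse power series with leading coefficient of absolute value one does not vanish at `x`
when `x ^ 4 < 1 - x ^ 2`. -/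
lemma le_abs_sum_of_sparse {x : ℝ} (hx0 : 0 ≤ x) (hx1 : x < 1) {ε : ℕ → ℝ} (B : ℕ)
    (h1 : |ε 1| = 1) (h3 : ε 3 = 0) (heven : ∀ j < B + 2, ε (2 * j) = 0) (hle : ∀ i, |ε i| ≤ 1) :
    x ^ 2 - x ^ 6 / (1 - x ^ 2) ≤ |∑ i ∈ Finset.range (2 * (B + 2)), ε i * x ^ (i + 1)| := by
  have hw : 0 < 1 - x ^ 2 := by nlinarith
  have key : |∑ i ∈ Finset.range (2 * (B + 2)), ε i * x ^ (i + 1) - ε 1 * x ^ 2|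
      ≤ x ^ 6 / (1 - x ^ 2) - x ^ (2 * B + 6) / (1 - x ^ 2) := by
    induction B with
    | zero =>
      have h0 := heven 0 (by norm_num)
      have h2 := heven 1 (by norm_num)
      norm_num at h0 h2
      simp [Finset.sum_range_succ, h0, h2, h3]
    | succ B ih =>
      have hstep : ∑ i ∈ Finset.range (2 * (B + 1 + 2)), ε i * x ^ (i + 1)
          = ∑ i ∈ Finset.range (2 * (B + 2)), ε i * x ^ (i + 1)
            + ε (2 * B + 5) * x ^ (2 * B + 6) := by
        rw [show 2 * (B + 1 + 2) = 2 * (B + 2) + 1 + 1 by ring, Finset.sum_range_succ,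
          Finset.sum_range_succ, heven (B + 2) (by omega), zero_mul, add_zero,
          show 2 * (B + 2) + 1 = 2 * B + 5 by ring]
      have hnew : |ε (2 * B + 5) * x ^ (2 * B + 6)| ≤ x ^ (2 * B + 6) := by
        rw [abs_mul, abs_of_nonneg (pow_nonneg hx0 _)]
        exact mul_le_of_le_one_left (pow_nonneg hx0 _) (hle _)
      have hgeom : x ^ (2 * B + 6) / (1 - x ^ 2)
          = x ^ (2 * B + 6) + x ^ (2 * (B + 1) + 6) / (1 - x ^ 2) := by
        field_simp
        ring
      have := ih fun j hj => heven j (by omega)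
      rw [hstep, add_sub_right_comm]
      refine (abs_add_le _ _).trans ?_
      linarith
  have h4 : |ε 1 * x ^ 2| = x ^ 2 := by rw [abs_mul, h1, one_mul, abs_of_nonneg (by positivity)]
  have h5 := abs_sub_abs_le_abs_sub (ε 1 * x ^ 2)
    (∑ i ∈ Finset.range (2 * (B + 2)), ε i * x ^ (i + 1))
  rw [abs_sub_comm, h4] at h5
  have h6 : 0 ≤ x ^ (2 * B + 6) / (1 - x ^ 2) := by positivity
  linarith

/-- The value at `1 / β` of the difference, on the window of length `A` after `2 ^ p`, between the
sequences `thueMorse (n ^ m)` read from `2 ^ (m * p - v) * q` and `2 ^ (m * p - v + 1) * q`. -/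
noncomputable def windowDifference (β : ℝ) (m q v A p : ℕ) : ℝ :=
  ∑ i ∈ Finset.range A, ((thueMorse ((2 ^ (m * p - v) * q + (2 ^ p + i)) ^ m) : ℝ)
    - thueMorse ((2 ^ (m * p - v + 1) * q + (2 ^ p + i)) ^ m)) / β ^ (i + 1)

lemma exists_le_abs_windowDifference_one {β : ℝ} (hβ : 1 < β) :
    ∃ c : ℝ, 0 < c ∧ ∀ B : ℕ, ∃ A ≥ B, ∀ᶠ p in Filter.atTop,
      c ≤ |windowDifference β 1 1 0 A p| := by
  obtain ⟨c, hc, hprod⟩ := exists_le_prod_one_sub_pow_two_pow (x := β⁻¹) (by positivity)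
    (inv_lt_one_of_one_lt₀ hβ)
  refine ⟨β⁻¹ * c, by positivity, fun B => ⟨2 ^ B, Nat.lt_two_pow_self.le, ?_⟩⟩
  filter_upwards [Filter.eventually_ge_atTop B] with p hp
  have heq : windowDifference β 1 1 0 (2 ^ B) p
      = β⁻¹ * ∑ i ∈ Finset.range (2 ^ B), (1 - 2 * (thueMorse i : ℝ)) * β⁻¹ ^ i := by
    rw [windowDifference, Finset.mul_sum]
    refine Finset.sum_congr rfl fun i hi => ?_
    have hi' : i < 2 ^ p :=
      (Finset.mem_range.mp hi).trans_le (Nat.pow_le_pow_right (by norm_num) hp)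
    have h1 : thueMorse ((2 ^ (1 * p - 0) * 1 + (2 ^ p + i)) ^ 1) = (thueMorse i + 1) % 2 := by
      rw [show (2 ^ (1 * p - 0) * 1 + (2 ^ p + i)) ^ 1 = i + 2 ^ (p + 1) * 1 by
        simp; ring, thueMorse_add_two_pow_mul _ (by rw [pow_succ]; omega),
        show thueMorse 1 = 1 by simp [thueMorse]]
    have h2 : thueMorse ((2 ^ (1 * p - 0 + 1) * 1 + (2 ^ p + i)) ^ 1) = thueMorse i := by
      rw [show (2 ^ (1 * p - 0 + 1) * 1 + (2 ^ p + i)) ^ 1 = i + 2 ^ p * 3 by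
        simp; ring, thueMorse_add_two_pow_mul _ hi', show thueMorse 3 = 0 by simp [thueMorse]]
      have := thueMorse_le_one i
      omega
    rw [h1, h2, div_eq_mul_inv, ← inv_pow, pow_succ]
    have := thueMorse_le_one i
    interval_cases thueMorse i <;> norm_num <;> ring
  rw [heq, sum_range_two_pow_thueMorse, abs_mul, abs_of_pos (by positivity : 0 < β⁻¹)]
  gcongr
  exact (hprod B).trans (le_abs_self _)

lemma exists_le_abs_windowDifference_of_two_le {β : ℝ} (hβ : 1 < β)
    (hgold : Real.goldenRatio < β ^ 2) {m m' v : ℕ} (hm : 2 ≤ m) (hm' : m = 2 ^ v * m')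
    (hodd : Odd m') :
    ∃ (q : ℕ) (c : ℝ), 1 ≤ q ∧ 0 < c ∧ ∀ B : ℕ, ∃ A ≥ B, ∀ᶠ p in Filter.atTop,
      c ≤ |windowDifference β m q v A p| := by
  obtain ⟨q, g, g', hq, hg, hg', h1, h3⟩ := exists_multiplier_trailing_ones m m' hm hodd
  have hx0 : 0 < β⁻¹ := by positivity
  have hx1 : β⁻¹ < 1 := inv_lt_one_of_one_lt₀ hβ
  refine ⟨q, β⁻¹ ^ 2 - β⁻¹ ^ 6 / (1 - β⁻¹ ^ 2), hq, ?_, fun B => ⟨2 * (B + 2), by omega, ?_⟩⟩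
  · have hw : 0 < 1 - β⁻¹ ^ 2 := by nlinarith
    have hβ2 : β⁻¹ ^ 2 * β ^ 2 = 1 := by
      rw [← mul_pow, inv_mul_cancel₀ (by positivity), one_pow]
    have hlt : β⁻¹ ^ 4 < 1 - β⁻¹ ^ 2 := by
      have h4 : β ^ 2 + 1 < (β ^ 2) ^ 2 := by
        nlinarith [Real.goldenRatio_sq, Real.one_lt_goldenRatio]
      have h5 : 0 < (β⁻¹ ^ 2) ^ 2 * ((β ^ 2) ^ 2 - (β ^ 2 + 1)) :=
        mul_pos (by positivity) (by linarith)
      have h6 : (β⁻¹ ^ 2) ^ 2 * ((β ^ 2) ^ 2 - (β ^ 2 + 1)) = 1 - β⁻¹ ^ 2 - β⁻¹ ^ 4 := by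
        linear_combination (β⁻¹ ^ 2 * β ^ 2 + 1 - β⁻¹ ^ 2) * hβ2
      linarith
    rw [sub_pos, div_lt_iff₀ hw]
    calc β⁻¹ ^ 6 = β⁻¹ ^ 2 * β⁻¹ ^ 4 := by ring
      _ < β⁻¹ ^ 2 * (1 - β⁻¹ ^ 2) := by gcongr
  filter_upwards [eventually_windowBound (by omega : 1 ≤ m) hq v (2 * (B + 2)),
    Filter.eventually_ge_atTop (g + g' + 1)] with p hw hp
  have hmod : ∀ {i e : ℕ}, e + 1 ≤ p →
      m' * q * (2 ^ p + i) ^ (m - 1) + 1 ≡ m' * q * i ^ (m - 1) + 1 [MOD 2 ^ (e + 1)] := by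
    intro i e he
    refine Nat.ModEq.add_right _ (Nat.ModEq.mul_left _ (Nat.ModEq.pow _ ?_))
    have : 2 ^ p ≡ 0 [MOD 2 ^ (e + 1)] := (Nat.modEq_zero_iff_dvd).mpr (pow_dvd_pow 2 he)
    simpa using this.add_right i
  have habs : ∀ a b : ℕ, |(thueMorse a : ℝ) - thueMorse b| ≤ 1 := by
    intro a b
    have ha := thueMorse_le_one a
    have hb := thueMorse_le_one b
    interval_cases thueMorse a <;> interval_cases thueMorse b <;> norm_num
  have hzero : ∀ a b : ℕ, (thueMorse a + thueMorse b) % 2 = 0 →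
      (thueMorse a : ℝ) - thueMorse b = 0 := by
    intro a b h
    have ha := thueMorse_le_one a
    have hb := thueMorse_le_one b
    rw [sub_eq_zero, show thueMorse a = thueMorse b by omega]
  have hm1 : 1 ≤ m := by omega
  have := le_abs_sum_of_sparse hx0.le hx1 B
    (ε := fun i => (thueMorse ((2 ^ (m * p - v) * q + (2 ^ p + i)) ^ m) : ℝ)
      - thueMorse ((2 ^ (m * p - v + 1) * q + (2 ^ p + i)) ^ m)) ?_ ?_ ?_ fun i => habs _ _
  · refine this.trans_eq ?_
    rw [windowDifference]
    simp_rw [div_eq_mul_inv, inv_pow]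
  · have hpar := hw.thueMorse_add_thueMorse_of_trailing_ones hm1 hm' (i := 1) (g := g) (by omega)
      ((hmod (by omega)).trans (by simpa using h1))
    have ha := thueMorse_le_one ((2 ^ (m * p - v) * q + (2 ^ p + 1)) ^ m)
    have hb := thueMorse_le_one ((2 ^ (m * p - v + 1) * q + (2 ^ p + 1)) ^ m)
    rw [hg] at hpar
    generalize thueMorse ((2 ^ (m * p - v) * q + (2 ^ p + 1)) ^ m) = a at *
    generalize thueMorse ((2 ^ (m * p - v + 1) * q + (2 ^ p + 1)) ^ m) = b at *
    obtain ⟨rfl, rfl⟩ | ⟨rfl, rfl⟩ : a = 0 ∧ b = 1 ∨ a = 1 ∧ b = 0 := by omega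
    all_goals norm_num
  · exact hzero _ _ ((hw.thueMorse_add_thueMorse_of_trailing_ones hm1 hm' (i := 3) (g := g')
      (by omega) ((hmod (by omega)).trans h3)).trans hg')
  · intro j hj
    refine hzero _ _ (hw.thueMorse_add_thueMorse_of_trailing_ones hm1 hm' (i := 2 * j) (g := 0)
      (by omega) ((hmod (by omega)).trans ?_))
    have : m' * q * (2 * j) ^ (m - 1) ≡ 0 [MOD 2] := (Nat.modEq_zero_iff_dvd).mpr
      (Dvd.dvd.mul_left (Dvd.dvd.pow (dvd_mul_right 2 j) (by omega)) _)
    exact this.add_right 1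

lemma exists_le_abs_windowDifference {β : ℝ} (hβ : 1 < β)
    (hgold : Real.goldenRatio < β ^ 2) {m : ℕ} (hm : 1 ≤ m) :
    ∃ (q v m' : ℕ) (c : ℝ), 1 ≤ q ∧ m = 2 ^ v * m' ∧ 0 < c ∧ ∀ B : ℕ, ∃ A ≥ B,
      ∀ᶠ p in Filter.atTop, c ≤ |windowDifference β m q v A p| := by
  rcases hm.eq_or_lt with rfl | hm2
  · obtain ⟨c, hc, h⟩ := exists_le_abs_windowDifference_one hβ
    exact ⟨1, 0, 1, c, le_rfl, rfl, hc, h⟩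
  · obtain ⟨v, m', hodd, hm'⟩ := Nat.exists_eq_two_pow_mul_odd (n := m) (by omega)
    obtain ⟨q, c, hq, hc, h⟩ := exists_le_abs_windowDifference_of_two_le hβ hgold hm2 hm' hodd
    exact ⟨q, v, m', c, hq, hm', hc, h⟩

lemma eventually_mul_pow_lt_pow_two_pow {β : ℝ} (hβ : 1 < β) (K : ℝ) (e : ℕ) :
    ∀ᶠ p : ℕ in Filter.atTop, K * ((2 : ℝ) ^ p) ^ e < β ^ 2 ^ p := by
  have h1 : Filter.Tendsto (fun p : ℕ => (2 : ℕ) ^ p) Filter.atTop Filter.atTop :=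
    tendsto_pow_atTop_atTop_of_one_lt (by norm_num)
  have h2 := ((tendsto_pow_const_div_const_pow_of_one_lt e hβ).comp h1).const_mul K
  rw [mul_zero] at h2
  filter_upwards [h2.eventually_lt_const one_pos] with p hp
  simp only [Function.comp_apply, Nat.cast_pow, Nat.cast_ofNat, ← mul_div_assoc] at hp
  rwa [div_lt_one (by positivity)] at hp

/-- The leading coefficient of a linear relation with coefficients in `ℤ[β]` vanishes. -/
lemma IsPisotOrSalem.aeval_eq_zero_of_relation {β : ℝ} (hβ : IsPisotOrSalem β)
    (hgold : Real.goldenRatio < β ^ 2) {k : ℕ} (hk : 1 ≤ k) (P : ℕ → ℤ[X])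
    (hsum : aeval β (P 0) + ∑ r ∈ Finset.Icc 1 k,
      aeval β (P r) * ∑' n : ℕ, (thueMorse ((n + 1) ^ r) : ℝ) / β ^ (n + 1) = 0) :
    aeval β (P k) = 0 := by
  have hβ1 := hβ.1
  choose D hD0 hD using fun r => exists_norm_aeval_le (P r)
  let W : ℕ → ℤ[X] := fun n => ∑ r ∈ Finset.Icc 1 k, C (thueMorse ((n + 1) ^ r) : ℤ) * P r
  have ht0 : ∀ n, (0 : ℝ) ≤ thueMorse n := fun n => Nat.cast_nonneg _
  have ht1 : ∀ n, (thueMorse n : ℝ) ≤ 1 := fun n => by exact_mod_cast thueMorse_le_one n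
  have hWβ' : ∀ n, aeval β (W n)
      = ∑ r ∈ Finset.Icc 1 k, aeval β (P r) * (thueMorse ((n + 1) ^ r) : ℝ) := fun n => by
    simp [W, mul_comm]
  set S₁ := ∑ r ∈ Finset.Icc 1 k, D r
  set S₂ := ∑ r ∈ Finset.Icc 1 k, |aeval β (P r)|
  have hS₁ : 0 ≤ S₁ := Finset.sum_nonneg fun r _ => hD0 r
  have hS₂ : 0 ≤ S₂ := Finset.sum_nonneg fun r _ => abs_nonneg _
  set C₀ : ℝ := 1 + D 0 + S₁ + S₂
  have hD00 := hD0 0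
  have hWC : ∀ n, ∀ z : ℂ, ‖z‖ ≤ 1 → ‖aeval z (W n)‖ ≤ C₀ := by
    intro n z hz
    have : ‖aeval z (W n)‖ ≤ S₁ := by
      simp only [W, map_sum, map_mul, aeval_C]
      refine (norm_sum_le _ _).trans (Finset.sum_le_sum fun r _ => ?_)
      rw [norm_mul]
      refine (mul_le_of_le_one_left (norm_nonneg _) ?_).trans (hD r z hz)
      simpa using ht1 _
    linarith
  have hWβ : ∀ n, |aeval β (W n)| ≤ C₀ := by
    intro n
    have : |aeval β (W n)| ≤ S₂ := by
      rw [hWβ']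
      refine (Finset.abs_sum_le_sum_abs _ _).trans (Finset.sum_le_sum fun r _ => ?_)
      rw [abs_mul, abs_of_nonneg (ht0 _)]
      exact mul_le_of_le_one_right (abs_nonneg _) (ht1 _)
    linarith
  have h0 : aeval β (P 0) + ∑' n : ℕ, aeval β (W n) / β ^ (n + 1) = 0 := by
    rw [← hsum]
    congr 1
    simp_rw [hWβ', Finset.sum_div, mul_div_assoc]
    rw [Summable.tsum_finsetSum fun r _ => (summable_div_pow_succ hβ1 (C := 1) fun n => by
      rw [abs_of_nonneg (ht0 _)]; exact ht1 _).mul_left _]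
    exact Finset.sum_congr rfl fun r _ => tsum_mul_left
  obtain ⟨d, K, hK⟩ := hβ.exists_tsum_eq_tsum (P := P 0) (W := W) (C := C₀) (by linarith)
    (fun z hz => (hD 0 z hz).trans (by linarith)) hWC hWβ h0
  obtain ⟨q, v, m', c, hq, hm', hc, hsep⟩ := exists_le_abs_windowDifference hβ1 hgold hk
  by_contra hne
  have hb : 0 < |aeval β (P k)| := abs_pos.mpr hne
  obtain ⟨B, hB⟩ : ∃ B : ℕ, ∀ A ≥ B, (C₀ + C₀) / (β - 1) / β ^ A < |aeval β (P k)| * c := by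
    have := (tendsto_pow_atTop_atTop_of_one_lt hβ1).const_div_atTop ((C₀ + C₀) / (β - 1))
    exact Filter.eventually_atTop.mp (this.eventually_lt_const (by positivity))
  obtain ⟨A, hAB, hA⟩ := hsep B
  obtain ⟨p, hpA, hw, hgrow⟩ := (hA.and ((eventually_windowBound hk hq v A).and
    (eventually_mul_pow_lt_pow_two_pow hβ1 (|K| * (3 * q) ^ d) (k * d)))).exists
  set s := k * p - v
  have hqs : ∀ e : ℕ, 1 ≤ 2 ^ e * q := fun e => Nat.mul_pos (Nat.two_pow_pos e) hq
  have hWs : ∀ e n : ℕ, aeval β (W (2 ^ e * q - 1 + n))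
      = ∑ r ∈ Finset.Icc 1 k, aeval β (P r) * (thueMorse ((2 ^ e * q + n) ^ r) : ℝ) := by
    intro e n
    have := hqs e
    rw [hWβ', show 2 ^ e * q - 1 + n + 1 = 2 ^ e * q + n by omega]
  have hδ : ∀ n < 2 ^ p + A,
      aeval β (W (2 ^ s * q - 1 + n)) - aeval β (W (2 ^ (s + 1) * q - 1 + n))
        = aeval β (P k) * ((thueMorse ((2 ^ s * q + n) ^ k) : ℝ)
          - thueMorse ((2 ^ (s + 1) * q + n) ^ k)) := by
    intro n hn
    rw [hWs, hWs, ← Finset.sum_sub_distrib,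
      Finset.sum_eq_single_of_mem k (Finset.mem_Icc.mpr ⟨hk, le_rfl⟩), mul_sub]
    intro r hr hrk
    rw [hw.thueMorse_eq_of_lt (lt_of_le_of_ne (Finset.mem_Icc.mp hr).2 hrk) hn, sub_self]
  have hagree : ∀ n < 2 ^ p,
      aeval β (W (2 ^ s * q - 1 + n)) - aeval β (W (2 ^ (s + 1) * q - 1 + n)) = 0 := by
    intro n hn
    rw [hδ n (by omega), hw.thueMorse_eq_of_lt_two_pow hk hm' hn, sub_self, mul_zero]
  have hbig : K * (((2 ^ s * q - 1 : ℕ) : ℝ) + (2 ^ (s + 1) * q - 1 : ℕ) + 2) ^ d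
      < β ^ 2 ^ p := by
    refine lt_of_le_of_lt ?_ hgrow
    have hcast : ((2 ^ s * q - 1 : ℕ) : ℝ) + (2 ^ (s + 1) * q - 1 : ℕ) + 2
        = 3 * q * 2 ^ s := by
      rw [Nat.cast_sub (hqs s), Nat.cast_sub (hqs (s + 1))]
      push_cast
      ring
    have hsp : (2 : ℝ) ^ s ≤ (2 ^ p) ^ k := by
      rw [← pow_mul, mul_comm p k]
      exact pow_le_pow_right₀ (by norm_num) (by omega)
    rw [hcast, mul_pow, ← mul_assoc, pow_mul _ k d]
    gcongr
    exact le_abs_self K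
  have hzero := hK _ _ (2 ^ p) (fun n hn => sub_eq_zero.mp (hagree n hn)) hbig
  have hfin := abs_sum_range_le_of_tsum_eq_zero hβ1 (C := C₀ + C₀)
    (fun n => (abs_sub _ _).trans (add_le_add (hWβ _) (hWβ _))) hagree hzero A
  rw [Finset.sum_congr rfl fun i hi => by
    rw [hδ (2 ^ p + i) (by have := Finset.mem_range.mp hi; omega), mul_div_assoc],
    ← Finset.mul_sum, abs_mul] at hfin
  have := (mul_le_mul_of_nonneg_left hpA hb.le).trans hfin
  exact absurd (hB A hAB) (not_lt.mpr this)

theorem linear_independence_thueMorse_powers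
    (β : ℝ) (hβ : IsPisotOrSalem β) (hgt : Real.sqrt Real.goldenRatio < β)
    (k : ℕ) (a : ℕ → ℝ)
    (ha : ∀ i ≤ k, a i ∈ IntermediateField.adjoin ℚ ({β} : Set ℝ))
    (hsum : a 0 + ∑ r ∈ Finset.Icc 1 k,
      a r * ∑' n : ℕ, (thueMorse ((n + 1) ^ r) : ℝ) / β ^ (n + 1) = 0) :
    ∀ i ≤ k, a i = 0 := by
  have hgold : Real.goldenRatio < β ^ 2 :=
    (Real.sqrt_lt' (one_pos.trans hβ.1)).mp hgt
  induction k with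
  | zero =>
    intro i hi
    obtain rfl : i = 0 := by omega
    simpa using hsum
  | succ k ih =>
    have hlast : a (k + 1) = 0 := by
      obtain ⟨D, P, hD, hP⟩ := exists_intPolynomial_of_mem_adjoin hβ.2.1 (k + 1) a ha
      have h := hβ.aeval_eq_zero_of_relation hgold (Nat.le_add_left 1 k) P (by
        rw [hP 0 (Nat.zero_le _), Finset.sum_congr rfl fun r hr => by
          rw [hP r (Finset.mem_Icc.mp hr).2, mul_assoc], ← Finset.mul_sum, ← mul_add, hsum,
          mul_zero])
      rw [hP _ le_rfl] at h
      exact (mul_eq_zero.mp h).resolve_left (Int.cast_ne_zero.mpr hD)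
    rw [Finset.sum_Icc_succ_top (by omega), hlast, zero_mul, add_zero] at hsum
    intro i hi
    rcases hi.eq_or_lt with rfl | hlt
    · exact hlast
    · exact ih (fun j hj => ha j (by omega)) hsum i (by omega)
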